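/- arXiv:2211.12397 — 2 statements merged into one kernel-verified Lean document; each statement's English description precedes it below -/
import Mathlib

section
/- The set of functions ℕ → ℕ that arise as the enumeration of some well-quasi-ordered permutation class is uncountable. Equivalently: there exists an uncountable family of well-quasi-ordered permutation classes whose enumeration functions are pairwise distinct. -/
/-- Permutations of all finite lengths. -/
abbrev Perms : Type := Σ n : ℕ, Equiv.Perm (Fin n)

/-- Pattern containment: `σ` is contained in `π` if some strictly monotone choice of
positions of `π` induces a subsequence order isomorphic to `σ`. -/
def PermContained (σ π : Perms) : Prop :=
  ∃ f : Fin σ.1 → Fin π.1, StrictMono f ∧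
    ∀ i j : Fin σ.1, σ.2 i < σ.2 j ↔ π.2 (f i) < π.2 (f j)

/-- A permutation class: a downward-closed set of permutations. -/
def IsPermClass (C : Set Perms) : Prop :=
  ∀ π ∈ C, ∀ σ : Perms, PermContained σ π → σ ∈ C

/-- A set of permutations is well-quasi-ordered if every infinite sequence from it
contains an increasing pair. -/
def IsWqoPermSet (C : Set Perms) : Prop :=
  ∀ f : ℕ → Perms, (∀ n, f n ∈ C) → ∃ m n, m < n ∧ PermContained (f m) (f n)

/-- The enumeration function of a set of permutations. -/
noncomputable def permEnum (C : Set Perms) : ℕ → ℕ :=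
  fun n => Set.ncard {π ∈ C | π.1 = n}

/-! ### The words -/

/-- Pattern table. -/
def wtbl (e : Bool) (r : ℕ) : Bool :=
  if e then !(decide (r < 10 ∨ r = 22 ∨ r = 35 ∨ r = 36)) else decide (r ≠ 0)

/-- The Toeplitz word with parameter `ε`. -/
def wW (ε : ℕ → Bool) (n : ℕ) : Bool :=
  if h : n % 50 = 49 then wW (fun i => ε (i + 1)) (n / 50) else wtbl (ε 0) (n % 50)
termination_by n
decreasing_by omega

theorem wW_last (k : ℕ) : ∀ (ε : ℕ → Bool) (q : ℕ),
    wW ε (50 ^ k * q + (50 ^ k - 1)) = wW (fun i => ε (i + k)) q := by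
  induction k with
  | zero => intro ε q; simp
  | succ k ih =>
    intro ε q
    have hp : 0 < 50 ^ k := by positivity
    have e : 50 ^ (k + 1) * q + (50 ^ (k + 1) - 1) = 50 * (50 ^ k * q + (50 ^ k - 1)) + 49 := by
      have : 50 ^ (k + 1) * q = 50 * (50 ^ k * q) := by ring
      have : 50 ^ (k + 1) = 50 * 50 ^ k := by ring
      omega
    rw [e, wW, dif_pos (by omega)]
    have e2 : (50 * (50 ^ k * q + (50 ^ k - 1)) + 49) / 50 = 50 ^ k * q + (50 ^ k - 1) := by omega
    rw [e2, ih]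
    congr 1

theorem wW_indep (k : ℕ) : ∀ (ε ε' : ℕ → Bool) (q q' r : ℕ), (∀ i < k, ε i = ε' i) →
    r < 50 ^ k - 1 → wW ε (50 ^ k * q + r) = wW ε' (50 ^ k * q' + r) := by
  induction k with
  | zero => intro ε ε' q q' r _ h; simp at h
  | succ k ih =>
    intro ε ε' q q' r hε h
    have hp : 0 < 50 ^ k := by positivity
    have e1 : 50 ^ (k + 1) * q = 50 * (50 ^ k * q) := by ring
    have e2 : 50 ^ (k + 1) * q' = 50 * (50 ^ k * q') := by ring
    have e3 : 50 ^ (k + 1) = 50 * 50 ^ k := by ring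
    rw [wW, wW.eq_1 ε']
    have m1 : (50 ^ (k + 1) * q + r) % 50 = r % 50 := by omega
    have m2 : (50 ^ (k + 1) * q' + r) % 50 = r % 50 := by omega
    have d1 : (50 ^ (k + 1) * q + r) / 50 = 50 ^ k * q + r / 50 := by omega
    have d2 : (50 ^ (k + 1) * q' + r) / 50 = 50 ^ k * q' + r / 50 := by omega
    rw [m1, m2, d1, d2]
    by_cases hr : r % 50 = 49
    · rw [dif_pos hr, dif_pos hr]
      apply ih
      · intro i hi; exact hε (i + 1) (by omega)
      · omega
    · rw [dif_neg hr, dif_neg hr, hε 0 (by omega)]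

theorem wW_block (k : ℕ) (ε ε' : ℕ → Bool) (q q' r : ℕ) (hε : ∀ i < k, ε i = ε' i)
    (hr : r < 50 ^ k) (hz : wW (fun i => ε (i + k)) q = wW (fun i => ε' (i + k)) q') :
    wW ε (50 ^ k * q + r) = wW ε' (50 ^ k * q' + r) := by
  by_cases h : r < 50 ^ k - 1
  · exact wW_indep k ε ε' q q' r hε h
  · have : r = 50 ^ k - 1 := by omega
    rw [this, wW_last, wW_last, hz]

theorem wW_zero (ε : ℕ → Bool) : wW ε 0 = false := by
  rw [wW]; simp [wtbl]

/-- Recurrence. -/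
def WRec {α : Type} (w : ℕ → α) : Prop :=
  ∀ p m, ∃ R, ∀ p', ∃ q ≤ R, ∀ i < m, w (p + i) = w (p' + q + i)

/-- The doubled word: pins. -/
def pinW (ε : ℕ → Bool) (t : ℕ) : Bool × Bool := (decide (t % 2 = 0), wW ε (t / 2))

theorem pinW_rec (ε : ℕ → Bool) : WRec (pinW ε) := by
  intro p m
  obtain ⟨k, hk⟩ : ∃ k, p + m + 2 < 50 ^ k := ⟨p + m + 2, Nat.lt_pow_self (by norm_num)⟩
  refine ⟨4 * 50 ^ k, fun p' => ⟨2 * 50 ^ k * (p' / (2 * 50 ^ k) + 1) + p - p', ?_, ?_⟩⟩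
  · have := Nat.div_add_mod p' (2 * 50 ^ k)
    have := Nat.mod_lt p' (show 0 < 2 * 50 ^ k by positivity)
    rw [mul_add]
    omega
  · intro i hi
    have h1 := Nat.div_add_mod p' (2 * 50 ^ k)
    have h2 := Nat.mod_lt p' (show 0 < 2 * 50 ^ k by positivity)
    set a := p' / (2 * 50 ^ k)
    have e : p' + (2 * 50 ^ k * (a + 1) + p - p') + i = 2 * (50 ^ k * (a + 1)) + (p + i) := by
      rw [mul_add] at *
      rw [mul_add, mul_assoc] at *
      omega
    rw [e]
    unfold pinW
    have e1 : (2 * (50 ^ k * (a + 1)) + (p + i)) % 2 = (p + i) % 2 := by omega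
    have e2 : (2 * (50 ^ k * (a + 1)) + (p + i)) / 2 = 50 ^ k * (a + 1) + (p + i) / 2 := by omega
    rw [e1, e2]
    have := wW_indep k ε ε 0 (a + 1) ((p + i) / 2) (fun _ _ => rfl) (by omega)
    rw [mul_zero, zero_add] at this
    rw [this]

theorem wW_window0 (ε ε' : ℕ → Bool) (h : ε 0 = false) (h' : ε' 0 = true) (q : ℕ) :
    ∃ q', ∀ j < 12, wW ε (q + j) = wW ε' (q' + j) := by
  have hz : ∀ n, n % 50 ≠ 49 → wW ε n = decide (n % 50 ≠ 0) := by
    intro n hn; rw [wW, dif_neg hn]; simp [wtbl, h]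
  have hz' : ∀ n, n < 49 → wW ε' n = !(decide (n < 10 ∨ n = 22 ∨ n = 35 ∨ n = 36)) := by
    intro n hn
    have : n % 50 = n := by omega
    rw [wW, this, dif_neg (by omega)]; simp [wtbl, h']
  have hb : q % 50 < 50 := Nat.mod_lt _ (by norm_num)
  by_cases c0 : q % 50 = 0
  · refine ⟨22, fun j hj => ?_⟩
    rw [hz _ (by omega), hz' _ (by omega), ← decide_not, decide_eq_decide]
    omega
  by_cases c1 : q % 50 + 11 < 49
  · refine ⟨10, fun j hj => ?_⟩
    rw [hz _ (by omega), hz' _ (by omega), ← decide_not, decide_eq_decide]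
    omega
  cases hv : wW ε (q + (49 - q % 50)) with
  | true =>
    refine ⟨22 - (50 - q % 50), fun j hj => ?_⟩
    by_cases hj2 : j = 49 - q % 50
    · rw [hj2, hv, hz' _ (by omega), eq_comm, ← decide_not, decide_eq_true_eq]
      omega
    · rw [hz _ (by omega), hz' _ (by omega), ← decide_not, decide_eq_decide]
      omega
  | false =>
    refine ⟨35 - (49 - q % 50), fun j hj => ?_⟩
    by_cases hj2 : j = 49 - q % 50
    · rw [hj2, hv, hz' _ (by omega), eq_comm, ← decide_not, decide_eq_false_iff_not]
      omega
    · rw [hz _ (by omega), hz' _ (by omega), ← decide_not, decide_eq_decide]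
      omega

theorem wW_window (k : ℕ) (ε ε' : ℕ → Bool) (hε : ∀ i < k, ε i = ε' i) (h : ε k = false)
    (h' : ε' k = true) (p : ℕ) :
    ∃ p', ∀ i < 11 * 50 ^ k, wW ε (p + i) = wW ε' (p' + i) := by
  have hp : 0 < 50 ^ k := by positivity
  obtain ⟨q', hq'⟩ := wW_window0 (fun i => ε (i + k)) (fun i => ε' (i + k)) (by simpa using h)
    (by simpa using h') (p / 50 ^ k)
  refine ⟨50 ^ k * q' + p % 50 ^ k, fun i hi => ?_⟩
  have h1 := Nat.div_add_mod p (50 ^ k)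
  have h2 := Nat.mod_lt p hp
  have h3 := Nat.div_add_mod (p % 50 ^ k + i) (50 ^ k)
  have h4 := Nat.mod_lt (p % 50 ^ k + i) hp
  have h5 : (p % 50 ^ k + i) / 50 ^ k < 12 := by
    rw [Nat.div_lt_iff_lt_mul hp]; omega
  set j := (p % 50 ^ k + i) / 50 ^ k
  set q := p / 50 ^ k
  have e1 : p + i = 50 ^ k * (q + j) + (p % 50 ^ k + i) % 50 ^ k := by
    rw [mul_add]; omega
  have e2 : 50 ^ k * q' + p % 50 ^ k + i = 50 ^ k * (q' + j) + (p % 50 ^ k + i) % 50 ^ k := by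
    rw [mul_add]; omega
  rw [e1, e2]
  exact wW_block k ε ε' _ _ _ hε h4 (hq' j h5)

theorem wW_noperiod (k : ℕ) (ε ε' : ℕ → Bool) (hε : ∀ i < k, ε i = ε' i) (h : ε k = false)
    (h' : ε' k = true) (p : ℕ) (hm : ∀ j < 10 * 50 ^ k - 5, wW ε' (3 + j) = wW ε (p + j)) :
    False := by
  have hp : 0 < 50 ^ k := by positivity
  set l := 50 ^ k with hl
  -- the periodic word
  let g : ℕ → Prop := fun n => wW ε' (n % l) = true
  have gper : Function.Periodic g l := by
    intro n; simp [g]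
  have hz' : ∀ n, n < 10 → wW (fun i => ε' (i + k)) n = false := by
    intro n hn
    have : n % 50 = n := by omega
    rw [wW, this, dif_neg (by omega)]; simp [wtbl, h', hn]
  have hg : ∀ n < 10 * l, (wW ε' n = true ↔ g n) := by
    intro n hn
    have e : n = l * (n / l) + n % l := (Nat.div_add_mod n l).symm
    have h5 : n / l < 10 := by rw [Nat.div_lt_iff_lt_mul hp]; omega
    have := wW_block k ε' ε' (n / l) 0 (n % l) (fun _ _ => rfl) (Nat.mod_lt _ hp)
      (by rw [hz' _ h5, hz' _ (by norm_num)])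
    rw [← hl, ← e, mul_zero, zero_add] at this
    simp only [g]
    rw [this]
  have hz : ∀ n, n % 50 ≠ 49 → wW (fun i => ε (i + k)) n = decide (n % 50 ≠ 0) := by
    intro n hn; rw [wW, dif_neg hn]; simp [wtbl, h]
  obtain ⟨b, hb1, hb2, hb⟩ : ∃ b, p ≤ l * b ∧ l * b + l ≤ p + 4 * l ∧
      wW (fun i => ε (i + k)) b = true := by
    have h1 := Nat.div_add_mod p l
    have h2 := Nat.mod_lt p hp
    set q := p / l
    have e1 : l * (q + 1) = l * q + l := by ring
    have e2 : l * (q + 2) = l * q + 2 * l := by ring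
    have e3 : l * (q + 3) = l * q + 3 * l := by ring
    by_cases c1 : (q + 1) % 50 ≠ 49 ∧ (q + 1) % 50 ≠ 0
    · exact ⟨q + 1, by omega, by omega, by rw [hz _ c1.1]; simpa using c1.2⟩
    by_cases c2 : (q + 2) % 50 ≠ 49 ∧ (q + 2) % 50 ≠ 0
    · exact ⟨q + 2, by omega, by omega, by rw [hz _ c2.1]; simpa using c2.2⟩
    · exact ⟨q + 3, by omega, by omega, by
        rw [hz _ (by omega), decide_eq_true_eq]; omega⟩
  -- compare
  have key : ∀ r < l, (g (3 + (l * b - p) + r) ↔ (g r ∨ r = l - 1)) := by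
    intro r hr
    rw [← hg _ (by omega), add_assoc, hm _ (by omega)]
    have : p + (l * b - p + r) = l * b + r := by omega
    rw [this]
    by_cases hr2 : r < l - 1
    · rw [hl, wW_indep k ε ε' b 0 r hε hr2, mul_zero, zero_add, hg _ (by omega)]
      constructor
      · exact Or.inl
      · rintro (h1 | h1)
        · exact h1
        · omega
    · have : r = l - 1 := by omega
      rw [this, hl, wW_last, hb]
      simp
  have hgl : ¬ g (l - 1) := by
    rw [← hg _ (by omega)]
    have := wW_last k ε' 0
    rw [mul_zero, zero_add, hz' _ (by norm_num)] at this
    rw [hl, this]; simp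
  classical
  have c1 := Nat.filter_Ico_card_eq_of_periodic (3 + (l * b - p)) l g gper
  have c2 := Nat.filter_Ico_card_eq_of_periodic 0 l g gper
  rw [← c2, zero_add] at c1
  have : ((Finset.Ico (3 + (l * b - p)) (3 + (l * b - p) + l)).filter g) =
      (insert (l - 1) ((Finset.Ico 0 l).filter g)).map
        ⟨fun r => 3 + (l * b - p) + r, fun x y hxy => by simpa using hxy⟩ := by
    ext n
    simp only [Finset.mem_filter, Finset.mem_Ico, Finset.mem_map, Finset.mem_insert]
    constructor
    · rintro ⟨⟨h1, h2⟩, h3⟩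
      refine ⟨n - (3 + (l * b - p)), ?_, by change 3 + (l * b - p) + _ = n; omega⟩
      have e : n = 3 + (l * b - p) + (n - (3 + (l * b - p))) := by omega
      rw [e, key _ (by omega)] at h3
      rcases h3 with h3 | h3
      · exact Or.inr ⟨by omega, h3⟩
      · exact Or.inl h3
    · rintro ⟨r, h1, rfl⟩
      have hr : r < l := by
        rcases h1 with h1 | h1
        · omega
        · exact h1.1.2
      change (_ ≤ 3 + (l * b - p) + r ∧ 3 + (l * b - p) + r < _) ∧ g (3 + (l * b - p) + r)
      refine ⟨by omega, (key r hr).2 ?_⟩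
      rcases h1 with h1 | h1
      · exact Or.inr h1
      · exact Or.inl h1.2
  rw [this, Finset.card_map, Finset.card_insert_of_notMem (by simp [hgl])] at c1
  omega

/-! ### Configurations and classes -/

/-- x-coordinate of the pin at time `t`. -/
def pX (a : ℕ → Bool × Bool) (t : ℕ) : ℤ := 2 * (t : ℤ) - (if (a t).1 then 3 else 0)

/-- y-coordinate of the pin at time `t`. -/
def pY (a : ℕ → Bool × Bool) (t : ℕ) : ℤ :=
  if (a t).2 then 2 * (t : ℤ) + 4 - (if (a t).1 then 0 else 3)
  else -(2 * (t : ℤ) + 4 - (if (a t).1 then 0 else 3))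

/-- The class attached to a word. -/
def pCls (w : ℕ → Bool × Bool) : Set Perms :=
  {σ | ∃ (g : Fin σ.1 → ℕ) (a : ℕ → Bool × Bool),
    (∀ i j, i < j ↔ pX a (g i) < pX a (g j)) ∧
    (∀ i j, σ.2 i < σ.2 j ↔ pY a (g i) < pY a (g j)) ∧
    ∀ s m, (∀ k < m, s + k ∈ Set.range g) → ∃ p, ∀ k < m, a (s + k) = w (p + k)}

theorem pCls_inj {n : ℕ} {g : Fin n → ℕ} {a : ℕ → Bool × Bool}
    (h : ∀ i j, i < j ↔ pX a (g i) < pX a (g j)) : Function.Injective g := by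
  intro i j hij
  by_contra hne
  rcases lt_or_gt_of_ne hne with h1 | h1
  · rw [h, hij] at h1; exact lt_irrefl _ h1
  · rw [h, hij] at h1; exact lt_irrefl _ h1

theorem pCls_isPermClass (w : ℕ → Bool × Bool) : IsPermClass (pCls w) := by
  rintro π ⟨g, a, hx, hy, hr⟩ σ ⟨f, hf, hfs⟩
  refine ⟨g ∘ f, a, ?_, ?_, ?_⟩
  · intro i j
    rw [← hf.lt_iff_lt, hx]; rfl
  · intro i j
    rw [hfs, hy]; rfl
  · intro s m h
    refine hr s m fun k hk => ?_
    obtain ⟨i, hi⟩ := h k hk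
    exact ⟨f i, hi⟩

theorem pCls_mono {w w' : ℕ → Bool × Bool} {N : ℕ}
    (h : ∀ p, ∃ p', ∀ i < N, w (p + i) = w' (p' + i)) (σ : Perms) (hσ : σ ∈ pCls w)
    (hN : σ.1 ≤ N) : σ ∈ pCls w' := by
  obtain ⟨g, a, hx, hy, hr⟩ := hσ
  refine ⟨g, a, hx, hy, fun s m hm => ?_⟩
  have hmN : m ≤ N := by
    refine le_trans ?_ hN
    choose f hf using fun k : Fin m => hm k.1 k.2
    have : Function.Injective f := by
      intro i j hij
      have h1 := hf i
      rw [hij, hf j] at h1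
      exact Fin.ext (by omega)
    simpa using Fintype.card_le_of_injective f this
  obtain ⟨p, hp⟩ := hr s m hm
  obtain ⟨p', hp'⟩ := h p
  exact ⟨p', fun k hk => by rw [hp k hk, hp' k (by omega)]⟩

/-! ### Well-quasi-order -/

/-- Factor order on segments of `w`. -/
def SegLe (w : ℕ → Bool × Bool) (a b : ℕ × ℕ) : Prop :=
  ∃ q, q + a.2 ≤ b.2 ∧ ∀ i < a.2, w (a.1 + i) = w (b.1 + q + i)

theorem segLe_preorder (w : ℕ → Bool × Bool) : IsPreorder (ℕ × ℕ) (SegLe w) where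
  refl := fun a => ⟨0, by simp⟩
  trans := by
    rintro a b c ⟨q, h1, h2⟩ ⟨r, h3, h4⟩
    refine ⟨r + q, by omega, fun i hi => ?_⟩
    rw [h2 i hi, add_assoc, h4 (q + i) (by omega)]
    congr 1
    omega

theorem segLe_wqo (w : ℕ → Bool × Bool) (hw : WRec w) :
    (Set.univ : Set (ℕ × ℕ)).PartiallyWellOrderedOn (SegLe w) := by
  intro f
  obtain ⟨R, hR⟩ := hw (f 0).1.1 (f 0).1.2
  by_cases hb : ∃ k, 0 < k ∧ R + (f 0).1.2 ≤ (f k).1.2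
  · obtain ⟨k, hk, hk2⟩ := hb
    obtain ⟨q, hq, hq2⟩ := hR (f k).1.1
    exact ⟨0, k, hk, q, by omega, hq2⟩
  · push Not at hb
    let N := R + (f 0).1.2
    let F : ℕ → Fin (N + 1) × (Fin N → Bool × Bool) := fun k =>
      (⟨(f (k + 1)).1.2, lt_of_lt_of_le (hb (k + 1) (by omega)) (by omega)⟩,
        fun i => w ((f (k + 1)).1.1 + i))
    obtain ⟨i, j, hij, hF⟩ := Finite.exists_ne_map_eq_of_infinite F
    have main : ∀ i j, F i = F j → SegLe w (f (i + 1)).1 (f (j + 1)).1 := by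
      intro i j hF
      have h1 : (f (i + 1)).1.2 = (f (j + 1)).1.2 := congrArg (fun x => (x.1 : ℕ)) hF
      have h2 := congrArg Prod.snd hF
      refine ⟨0, by omega, fun r hr => ?_⟩
      have := congrFun h2 ⟨r, lt_trans hr (hb (i + 1) (by omega))⟩
      simpa [F] using this
    rcases lt_or_gt_of_ne hij with h | h
    · exact ⟨i + 1, j + 1, by omega, main i j hF⟩
    · exact ⟨j + 1, i + 1, by omega, main j i hF.symm⟩

/-- The finite set of times `T` with letters `a` is described by a list of segments of `w`. -/
def SegDesc (w a : ℕ → Bool × Bool) : List (ℕ × ℕ) → Finset ℕ → Prop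
  | [], T => T = ∅
  | x :: l, T => ∃ s T2, (∀ t, t ∈ T ↔ (s ≤ t ∧ t < s + x.2) ∨ t ∈ T2) ∧
      (∀ t ∈ T2, s + x.2 < t) ∧ (∀ i < x.2, a (s + i) = w (x.1 + i)) ∧ SegDesc w a l T2

theorem segDesc_exists (w a : ℕ → Bool × Bool) (n : ℕ) : ∀ (T : Finset ℕ), T.card = n →
    (∀ s m, (∀ k < m, s + k ∈ T) → ∃ p, ∀ k < m, a (s + k) = w (p + k)) →
    ∃ l, SegDesc w a l T := by
  induction n using Nat.strong_induction_on with
  | _ n ih =>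
  intro T hT hr
  rcases T.eq_empty_or_nonempty with h0 | h0
  · exact ⟨[], h0⟩
  have hs := T.min'_mem h0
  have hmin := fun t ht => T.min'_le t ht
  set s := T.min' h0
  have hex : ∃ m, s + m ∉ T := by
    obtain ⟨m, hm⟩ := Infinite.exists_notMem_finset (T.image (fun t => t - s))
    refine ⟨m, fun h => hm (Finset.mem_image.2 ⟨s + m, h, by omega⟩)⟩
  classical
  let m := Nat.find hex
  have hm1 : s + m ∉ T := Nat.find_spec hex
  have hm2 : ∀ k < m, s + k ∈ T := fun k hk => by
    have := Nat.find_min hex hk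
    simpa using this
  obtain ⟨p, hp⟩ := hr s m hm2
  let T2 := T.filter (fun t => s + m < t)
  have hlt : T2.card < n := by
    rw [← hT]
    apply Finset.card_lt_card
    refine Finset.ssubset_iff_subset_ne.2 ⟨Finset.filter_subset _ _, fun h => ?_⟩
    have h3 : s ∈ T2 := by rw [h]; exact hs
    have h4 := (Finset.mem_filter.1 h3).2
    omega
  obtain ⟨l, hl⟩ := ih _ hlt T2 rfl (fun s m h => hr s m (fun k hk =>
    (Finset.mem_filter.1 (h k hk)).1))
  refine ⟨(p, m) :: l, s, T2, ?_, ?_, hp, hl⟩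
  · intro t
    simp only [T2, Finset.mem_filter]
    constructor
    · intro ht
      have h1 := hmin t ht
      have h2 : t ≠ s + m := fun h => hm1 (h ▸ ht)
      by_cases h3 : t < s + m
      · exact Or.inl ⟨h1, h3⟩
      · exact Or.inr ⟨ht, by omega⟩
    · rintro (⟨h1, h2⟩ | h)
      · have := hm2 (t - s) (by omega)
        rwa [show s + (t - s) = t by omega] at this
      · exact h.1
  · intro t ht
    exact (Finset.mem_filter.1 ht).2

theorem segDesc_embed (w a a' : ℕ → Bool × Bool) {l l' : List (ℕ × ℕ)}
    (h : List.SublistForall₂ (SegLe w) l l') : ∀ T T' : Finset ℕ,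
    SegDesc w a l T → SegDesc w a' l' T' →
    ∃ φ : ℕ → ℕ, (∀ t ∈ T, φ t ∈ T' ∧ a' (φ t) = a t) ∧
      ∀ t ∈ T, ∀ t' ∈ T, t < t' → φ t < φ t' ∧ (φ t' = φ t + 1 ↔ t' = t + 1) := by
  induction h with
  | nil =>
    intro T T' h1 _
    have : T = ∅ := h1
    subst this
    exact ⟨id, by simp, by simp⟩
  | @cons x y l l' hxy _ ih =>
    rintro T T' ⟨s, T2, hT, hT2, ha, hd⟩ ⟨s', T2', hT', hT2', ha', hd'⟩
    obtain ⟨φ, h1, h2⟩ := ih T2 T2' hd hd'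
    obtain ⟨q, hq, hqw⟩ := hxy
    refine ⟨fun t => if t < s + x.2 then s' + q + (t - s) else φ t, ?_, ?_⟩
    · intro t ht
      rcases (hT t).1 ht with ⟨h3, h4⟩ | h3
      · simp only [h4, if_true]
        refine ⟨(hT' _).2 (Or.inl ⟨by omega, by omega⟩), ?_⟩
        rw [add_assoc, ha' _ (by omega), ← add_assoc, ← hqw _ (by omega), ← ha _ (by omega)]
        congr 1; omega
      · have := hT2 t h3
        simp only [show ¬ t < s + x.2 by omega, if_false]
        exact ⟨(hT' _).2 (Or.inr (h1 t h3).1), (h1 t h3).2⟩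
    · intro t ht t' ht' htt
      rcases (hT t).1 ht with ⟨h3, h4⟩ | h3
      · rcases (hT t').1 ht' with ⟨h5, h6⟩ | h5
        · simp only [h4, h6, if_true]
          omega
        · have h7 := hT2 t' h5
          have h8 := hT2' _ (h1 t' h5).1
          simp only [h4, if_true, show ¬ t' < s + x.2 by omega, if_false]
          omega
      · have h7 := hT2 t h3
        rcases (hT t').1 ht' with ⟨h5, h6⟩ | h5
        · omega
        · simp only [show ¬ t < s + x.2 by omega, show ¬ t' < s + x.2 by omega, if_false]
          exact h2 t h3 t' h5 htt
  | cons_right _ ih =>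
    rintro T T' h1 ⟨s', T2', hT', hT2', ha', hd'⟩
    obtain ⟨φ, h3, h4⟩ := ih T T2' h1 hd'
    exact ⟨φ, fun t ht => ⟨(hT' _).2 (Or.inr (h3 t ht).1), (h3 t ht).2⟩, h4⟩

theorem pXY_embed_lt {a a' : ℕ → Bool × Bool} {t t' u u' : ℕ} (h1 : a' u = a t)
    (h2 : a' u' = a t') (h : t < t') (h' : u < u') (hs : u' = u + 1 ↔ t' = t + 1) :
    ((pX a t < pX a t' ↔ pX a' u < pX a' u') ∧ (pX a t' < pX a t ↔ pX a' u' < pX a' u)) ∧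
    ((pY a t < pY a t' ↔ pY a' u < pY a' u') ∧ (pY a t' < pY a t ↔ pY a' u' < pY a' u)) := by
  unfold pX pY
  rw [h1, h2]
  by_cases hc : t' = t + 1
  · have hc' := hs.2 hc
    subst hc hc'
    push_cast
    refine ⟨⟨?_, ?_⟩, ?_, ?_⟩ <;> split_ifs <;> constructor <;> intro <;> omega
  · have hc' : u' ≠ u + 1 := fun h => hc (hs.1 h)
    refine ⟨⟨?_, ?_⟩, ?_, ?_⟩ <;> split_ifs <;> constructor <;> intro <;> omega

theorem pCls_wqo (w : ℕ → Bool × Bool) (hw : WRec w) : IsWqoPermSet (pCls w) := by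
  intro f hf
  choose g a hx hy hr using hf
  have hd : ∀ n, ∃ l, SegDesc w (a n) l (Finset.univ.image (g n)) := by
    intro n
    refine segDesc_exists w (a n) _ _ rfl ?_
    intro s m h
    exact hr n s m (fun k hk => by simpa using h k hk)
  choose l hl using hd
  have := segLe_preorder w
  have hig := (segLe_wqo w hw).partiallyWellOrderedOn_sublistForall₂ (SegLe w)
  obtain ⟨m, n, hmn, hs⟩ := hig (fun n => ⟨l n, fun x _ => Set.mem_univ x⟩)
  refine ⟨m, n, hmn, ?_⟩
  obtain ⟨φ, h1, h2⟩ := segDesc_embed w (a m) (a n) hs _ _ (hl m) (hl n)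
  have hmem : ∀ i, g m i ∈ Finset.univ.image (g m) := fun i => by simp
  have h3 : ∀ i, ∃ j, g n j = φ (g m i) := fun i => by
    have := (h1 _ (hmem i)).1
    simpa using this
  choose F hF using h3
  have key : ∀ i j, (pX (a m) (g m i) < pX (a m) (g m j) ↔
        pX (a n) (φ (g m i)) < pX (a n) (φ (g m j))) ∧
      (pY (a m) (g m i) < pY (a m) (g m j) ↔
        pY (a n) (φ (g m i)) < pY (a n) (φ (g m j))) := by
    intro i j
    rcases lt_trichotomy (g m i) (g m j) with h | h | h
    · have h4 := h2 _ (hmem i) _ (hmem j) h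
      have h5 := pXY_embed_lt (h1 _ (hmem i)).2 (h1 _ (hmem j)).2 h h4.1 h4.2
      exact ⟨h5.1.1, h5.2.1⟩
    · rw [h]; simp
    · have h4 := h2 _ (hmem j) _ (hmem i) h
      have h5 := pXY_embed_lt (h1 _ (hmem j)).2 (h1 _ (hmem i)).2 h h4.1 h4.2
      exact ⟨h5.1.2, h5.2.2⟩
  refine ⟨F, ?_, ?_⟩
  · intro i j hij
    rw [hx n, hF, hF, ← (key i j).1, ← hx m]
    exact hij
  · intro i j
    rw [hy n, hF, hF, ← (key i j).2, ← hy m]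

/-! ### Decoding -/

theorem step_lemma (h : ℕ → ℕ) (n : ℕ)
    (inj : ∀ s t, s < n → t < n → h s = h t → s = t)
    (hA : ∀ z t, z + 2 ≤ t → t < n → h z ≤ h t + 1)
    (hB : ∀ t, 3 ≤ t → t + 1 < n → h (t + 1) ≤ h t + 1)
    (t : ℕ) (ht : 3 ≤ t) (htn : t + 3 < n) : h (t + 1) = h t + 1 := by
  have a1 := hA t (t + 2) (by omega) (by omega)
  have a2 := hA t (t + 3) (by omega) (by omega)
  have b1 : h (t + 1) ≤ h t + 1 := hB t (by omega) (by omega)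
  have b2 : h (t + 2) ≤ h (t + 1) + 1 := hB (t + 1) (by omega) (by omega)
  have b3 : h (t + 3) ≤ h (t + 2) + 1 := hB (t + 2) (by omega) (by omega)
  have i1 : h t ≠ h (t + 1) := fun e => by have := inj _ _ (by omega) (by omega) e; omega
  have i2 : h t ≠ h (t + 2) := fun e => by have := inj _ _ (by omega) (by omega) e; omega
  have i3 : h t ≠ h (t + 3) := fun e => by have := inj _ _ (by omega) (by omega) e; omega
  have i4 : h (t + 1) ≠ h (t + 2) := fun e => by have := inj _ _ (by omega) (by omega) e; omega
  have i5 : h (t + 1) ≠ h (t + 3) := fun e => by have := inj _ _ (by omega) (by omega) e; omega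
  have i6 : h (t + 2) ≠ h (t + 3) := fun e => by have := inj _ _ (by omega) (by omega) e; omega
  omega

theorem pX_far (a : ℕ → Bool × Bool) {s t : ℕ} (h : s + 2 ≤ t) : pX a s < pX a t := by
  unfold pX; split_ifs <;> omega

theorem pY_far_true (a : ℕ → Bool × Bool) {s t : ℕ} (h : s + 2 ≤ t) (ht : (a t).2 = true) :
    pY a s < pY a t := by
  unfold pY; rw [ht]; split_ifs <;> simp at * <;> omega

theorem pY_far_false (a : ℕ → Bool × Bool) {s t : ℕ} (h : s + 2 ≤ t) (ht : (a t).2 = false) :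
    pY a t < pY a s := by
  unfold pY; rw [ht]; split_ifs <;> simp at * <;> omega

theorem pY_far_iff (a : ℕ → Bool × Bool) {s t : ℕ} (h : s + 2 ≤ t) :
    pY a s < pY a t ↔ (a t).2 = true := by
  cases ht : (a t).2 with
  | true => simp [pY_far_true a h ht]
  | false => simp [(pY_far_false a h ht).le]

theorem decode (ε : ℕ → Bool) (n : ℕ) (h : ℕ → ℕ) (a : ℕ → Bool × Bool)
    (inj : ∀ s t, s < n → t < n → h s = h t → s = t)
    (hx : ∀ s t, s < n → t < n → (pX (pinW ε) s < pX (pinW ε) t ↔ pX a (h s) < pX a (h t)))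
    (hy : ∀ s t, s < n → t < n → (pY (pinW ε) s < pY (pinW ε) t ↔ pY a (h s) < pY a (h t))) :
    (∀ i, i + 5 < n → h (3 + i) = h 3 + i) ∧
    (∀ i, i + 7 < n → (a (h 3 + 2 + i)).2 = wW ε ((5 + i) / 2)) := by
  have hA' : ∀ z t, z < n → t < n → pX (pinW ε) z < pX (pinW ε) t → h z ≤ h t + 1 := by
    intro z t hz ht hlt
    by_contra hc
    have := pX_far a (show h t + 2 ≤ h z by omega)
    have := (hx z t hz ht).1 hlt
    omega
  have hA : ∀ z t, z + 2 ≤ t → t < n → h z ≤ h t + 1 := fun z t h1 h2 =>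
    hA' z t (by omega) h2 (pX_far _ h1)
  have hB : ∀ t, 3 ≤ t → t + 1 < n → h (t + 1) ≤ h t + 1 := by
    intro t h3 htn
    by_cases hp : (t + 1) % 2 = 0
    · -- a vertical pin
      apply hA' (t + 1) t htn (by omega)
      unfold pX pinW
      have : t % 2 ≠ 0 := by omega
      simp [hp, this]
      omega
    · by_contra hc
      -- all earlier `z` satisfy `h (t+1) ≤ h z + 1`
      have hd : (t + 1) / 2 = t / 2 := by omega
      have ht2 : t % 2 = 0 := by omega
      have hz : ∀ z, z < t → h (t + 1) ≤ h z + 1 := by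
        intro z hz
        by_contra hc2
        cases hs : (pinW ε (t + 1)).2 with
        | true =>
          have k1 := pY_far_true (pinW ε) (show z + 2 ≤ t + 1 by omega) hs
          have k2 : pY (pinW ε) (t + 1) < pY (pinW ε) t := by
            unfold pinW at hs
            simp only [hd] at hs
            unfold pY pinW
            simp [hd, hs, hp, ht2]
            omega
          have k3 := (hy _ _ (by omega) htn).1 k1
          have k4 := (hy _ _ htn (by omega)).1 k2
          cases ha : (a (h (t + 1))).2 with
          | true =>
            have := pY_far_true a (show h t + 2 ≤ h (t + 1) by omega) ha
            omega
          | false =>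
            have := pY_far_false a (show h z + 2 ≤ h (t + 1) by omega) ha
            omega
        | false =>
          have k1 := pY_far_false (pinW ε) (show z + 2 ≤ t + 1 by omega) hs
          have k2 : pY (pinW ε) t < pY (pinW ε) (t + 1) := by
            unfold pinW at hs
            simp only [hd] at hs
            unfold pY pinW
            simp [hd, hs, hp, ht2]
            omega
          have k3 := (hy _ _ htn (by omega)).1 k1
          have k4 := (hy _ _ (by omega) htn).1 k2
          cases ha : (a (h (t + 1))).2 with
          | true =>
            have := pY_far_true a (show h z + 2 ≤ h (t + 1) by omega) ha
            omega
          | false =>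
            have := pY_far_false a (show h t + 2 ≤ h (t + 1) by omega) ha
            omega
      have z0 := hz 0 (by omega)
      have z1 := hz 1 (by omega)
      have z2 := hz 2 (by omega)
      have y0 := hA 0 (t + 1) (by omega) htn
      have y1 := hA 1 (t + 1) (by omega) htn
      have y2 := hA 2 (t + 1) (by omega) htn
      have i1 : h 0 ≠ h 1 := fun e => by have := inj _ _ (by omega) (by omega) e; omega
      have i2 : h 0 ≠ h 2 := fun e => by have := inj _ _ (by omega) (by omega) e; omega
      have i3 : h 1 ≠ h 2 := fun e => by have := inj _ _ (by omega) (by omega) e; omega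
      have i4 : h 0 ≠ h (t + 1) := fun e => by have := inj _ _ (by omega) (by omega) e; omega
      have i5 : h 1 ≠ h (t + 1) := fun e => by have := inj _ _ (by omega) (by omega) e; omega
      have i6 : h 2 ≠ h (t + 1) := fun e => by have := inj _ _ (by omega) (by omega) e; omega
      omega
  have hrun : ∀ i, i + 5 < n → h (3 + i) = h 3 + i := by
    intro i
    induction i with
    | zero => intro _; rfl
    | succ i ih =>
      intro hi
      have := step_lemma h n inj hA hB (3 + i) (by omega) (by omega)
      have := ih (by omega)
      rw [show 3 + (i + 1) = 3 + i + 1 by omega]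
      omega
  refine ⟨hrun, fun i hi => ?_⟩
  have e1 := hrun i (by omega)
  have e2 := hrun (i + 2) (by omega)
  have k := hy (3 + i) (3 + (i + 2)) (by omega) (by omega)
  rw [pY_far_iff _ (by omega), e1, e2, pY_far_iff _ (by omega)] at k
  have : h 3 + (i + 2) = h 3 + 2 + i := by omega
  rw [this] at k
  rw [Bool.eq_iff_iff, ← k]
  unfold pinW
  rw [show 3 + (i + 2) = 5 + i by omega]

theorem pX_inj (a : ℕ → Bool × Bool) : Function.Injective (pX a) := by
  intro s t h
  unfold pX at h; split_ifs at h <;> omega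

theorem pY_inj (a : ℕ → Bool × Bool) : Function.Injective (pY a) := by
  intro s t h
  unfold pY at h; split_ifs at h <;> omega

theorem pins_perm (a : ℕ → Bool × Bool) (n : ℕ) : ∃ (σ : Equiv.Perm (Fin n))
    (g : Equiv.Perm (Fin n)), (∀ i j, i < j ↔ pX a (g i) < pX a (g j)) ∧
      (∀ i j, σ i < σ j ↔ pY a (g i) < pY a (g j)) := by
  have hsort : ∀ f : Fin n → ℤ, Function.Injective f → StrictMono (f ∘ Tuple.sort f) := by
    intro f hf
    exact (Tuple.monotone_sort f).strictMono_of_injective (hf.comp (Equiv.injective _))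
  have h1 := hsort (fun i => pX a i) (fun i j h => Fin.ext (pX_inj a h))
  have h2 := hsort (fun i => pY a i) (fun i j h => Fin.ext (pY_inj a h))
  refine ⟨(Tuple.sort (fun i : Fin n => pX a i)).trans (Tuple.sort (fun i : Fin n => pY a i)).symm,
    Tuple.sort (fun i : Fin n => pX a i), ?_, ?_⟩
  · intro i j
    exact h1.lt_iff_lt.symm
  · intro i j
    rw [← h2.lt_iff_lt]
    simp

theorem cls_strict (k : ℕ) (ε ε' : ℕ → Bool) (hε : ∀ i < k, ε i = ε' i) (h : ε k = false)
    (h' : ε' k = true) :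
    permEnum (pCls (pinW ε)) ≠ permEnum (pCls (pinW ε')) := by
  have hp : 0 < 50 ^ k := by positivity
  set n := 20 * 50 ^ k with hn
  have hsub : {π ∈ pCls (pinW ε) | π.1 = n} ⊆ {π ∈ pCls (pinW ε') | π.1 = n} := by
    rintro π ⟨h1, h2⟩
    refine ⟨pCls_mono (N := n) ?_ π h1 h2.le, h2⟩
    intro p
    obtain ⟨p', hp'⟩ := wW_window k ε ε' hε h h' (p / 2)
    refine ⟨2 * p' + p % 2, fun i hi => ?_⟩
    unfold pinW
    have e1 : (2 * p' + p % 2 + i) % 2 = (p + i) % 2 := by omega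
    have e2 : (2 * p' + p % 2 + i) / 2 = p' + (p % 2 + i) / 2 := by omega
    have e3 : (p + i) / 2 = p / 2 + (p % 2 + i) / 2 := by omega
    rw [e1, e2, e3, hp' _ (by omega)]
  obtain ⟨σ, g, hgx, hgy⟩ := pins_perm (pinW ε') n
  have hin : (⟨n, σ⟩ : Perms) ∈ pCls (pinW ε') := by
    refine ⟨fun i => (g i : ℕ), pinW ε', hgx, hgy, fun s m _ => ⟨s, fun _ _ => rfl⟩⟩
  have hout : (⟨n, σ⟩ : Perms) ∉ pCls (pinW ε) := by
    rintro ⟨g2, a, hx, hy, hr⟩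
    change Fin n → ℕ at g2
    change ∀ i j : Fin n, _ at hx
    change ∀ i j : Fin n, _ at hy
    have g2i := pCls_inj hx
    let H : ℕ → ℕ := fun t => if ht : t < n then g2 (g.symm ⟨t, ht⟩) else 0
    have hH : ∀ t (ht : t < n), H t = g2 (g.symm ⟨t, ht⟩) := fun t ht => by simp [H, ht]
    have hd := decode ε' n H a
      (by
        intro s t hs ht e
        rw [hH s hs, hH t ht] at e
        simpa using g2i e)
      (by
        intro s t hs ht
        rw [hH s hs, hH t ht, ← hx, hgx]
        simp)
      (by
        intro s t hs ht
        rw [hH s hs, hH t ht, ← hy, hgy]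
        simp)
    obtain ⟨p, hpp⟩ := hr (H 3) (n - 5) (by
      intro i hi
      rw [← hd.1 i (by omega), hH _ (by omega)]
      exact ⟨_, rfl⟩)
    refine wW_noperiod k ε ε' hε h h' ((p + 3) / 2) ?_
    intro j hj
    have k1 := hd.2 (2 * j + 1) (by omega)
    have k2 := hpp (2 * j + 3) (by omega)
    rw [show H 3 + 2 + (2 * j + 1) = H 3 + (2 * j + 3) by omega, k2] at k1
    unfold pinW at k1
    simp only at k1
    rw [show (p + (2 * j + 3)) / 2 = (p + 3) / 2 + j by omega,
      show (5 + (2 * j + 1)) / 2 = 3 + j by omega] at k1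
    exact k1.symm
  intro heq
  have hc := congrFun heq n
  have hfin : {π ∈ pCls (pinW ε') | π.1 = n}.Finite := by
    refine (Set.finite_range (fun s : Equiv.Perm (Fin n) => (⟨n, s⟩ : Perms))).subset ?_
    rintro ⟨m, s⟩ ⟨_, h2⟩
    change m = n at h2
    subst h2
    exact ⟨s, rfl⟩
  have hlt := Set.ncard_lt_ncard (Set.ssubset_iff_subset_ne.2 ⟨hsub, fun e => hout (by
    have : (⟨n, σ⟩ : Perms) ∈ {π ∈ pCls (pinW ε') | π.1 = n} := ⟨hin, rfl⟩
    rw [← e] at this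
    exact this.1)⟩) hfin
  unfold permEnum at hc
  omega

theorem enum_inj : Function.Injective (fun ε : ℕ → Bool => permEnum (pCls (pinW ε))) := by
  intro ε ε' heq
  by_contra hne
  have hex : ∃ k, ε k ≠ ε' k := Function.ne_iff.1 hne
  classical
  have h1 := Nat.find_spec hex
  have h2 : ∀ i < Nat.find hex, ε i = ε' i := fun i hi => by
    simpa using Nat.find_min hex hi
  set k := Nat.find hex
  cases ha : ε k with
  | false =>
    exact cls_strict k ε ε' h2 ha (by rw [ha] at h1; simpa using h1.symm) heq
  | true =>
    exact cls_strict k ε' ε (fun i hi => (h2 i hi).symm) (by rw [ha] at h1; simpa using h1.symm)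
      ha heq.symm

theorem uncountably_many_wqo_class_enumerations :
    ¬ Set.Countable
        {g : ℕ → ℕ | ∃ C : Set Perms, IsPermClass C ∧ IsWqoPermSet C ∧ permEnum C = g} := by
  intro hc
  have h1 : (Set.range (fun ε : ℕ → Bool => permEnum (pCls (pinW ε)))).Countable := by
    refine hc.mono ?_
    rintro _ ⟨ε, rfl⟩
    exact ⟨pCls (pinW ε), pCls_isPermClass _, pCls_wqo _ (pinW_rec ε), rfl⟩
  have h2 : Countable (ℕ → Bool) := by
    have := h1.to_subtype
    refine Function.Injective.countable
      (f := fun ε : ℕ → Bool => (⟨_, ε, rfl⟩ :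
        Set.range (fun ε : ℕ → Bool => permEnum (pCls (pinW ε))))) ?_
    intro x y hxy
    exact enum_inj (congrArg Subtype.val hxy)
  obtain ⟨f, hf⟩ := exists_surjective_nat (ℕ → Bool)
  obtain ⟨n, hn⟩ := hf (fun n => !(f n n))
  have := congrFun hn n
  simp at this
end

section
/- For every sequence (s_k) of positive integers and every even i ≥ 2: the word [0] ++ (α_i^{(s)})^{s_i} ++ [0] is a factor of (ᾱ_i^{(s)})^{s_i} ++ (ᾱ_i^{(s)})^{s_i}, and the word [1] ++ (ᾱ_i^{(s)})^{s_i} ++ [1] is a factor of (α_i^{(s)})^{s_i} ++ (α_i^{(s)})^{s_i}. In particular, both words belong to L^{(s)}. -/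
/-- The complement of a binary word: negate every letter. -/
def wordCompl (w : List Bool) : List Bool := w.map Bool.not

/-- `wordPow u k` is the concatenation of `k` copies of `u`. -/
def wordPow (u : List Bool) (k : ℕ) : List Bool := (List.replicate k u).flatten

/-- Pouzet's words `α_i^{(s)}`: `α_1 = [0,1]`, `α_{i+1} = α_i^{s_i} ++ ᾱ_i^{s_i}`. -/
def alphaWord (s : ℕ → ℕ) : ℕ → List Bool
  | 0 => []
  | 1 => [false, true]
  | (i + 2) => wordPow (alphaWord s (i + 1)) (s (i + 1)) ++
      wordPow (wordCompl (alphaWord s (i + 1))) (s (i + 1))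

/-- The language `L^{(s)}` of all factors of the words `α_i^{(s)}`, `i ≥ 1`. -/
def langL (s : ℕ → ℕ) : Set (List Bool) :=
  {w | ∃ i, 1 ≤ i ∧ w <:+: alphaWord s i}


theorem wp_succ (u : List Bool) (n : ℕ) : wordPow u (n+1) = u ++ wordPow u n := by
  simp [wordPow, List.replicate_succ]

theorem wp_succ' (u : List Bool) (n : ℕ) : wordPow u (n+1) = wordPow u n ++ u := by
  simp [wordPow, List.replicate_succ']

theorem wc_append (u v : List Bool) : wordCompl (u ++ v) = wordCompl u ++ wordCompl v := by
  simp [wordCompl]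

theorem wc_wc (u : List Bool) : wordCompl (wordCompl u) = u := by
  induction u <;> simp_all [wordCompl]

theorem wc_wp (u : List Bool) (n : ℕ) : wordCompl (wordPow u n) = wordPow (wordCompl u) n := by
  induction n with
  | zero => simp [wordPow, wordCompl]
  | succ n ih => rw [wp_succ, wp_succ, wc_append, ih]

theorem wp_add (u : List Bool) (m n : ℕ) : wordPow u (m+n) = wordPow u m ++ wordPow u n := by
  simp only [wordPow, List.replicate_add, List.flatten_append]

theorem wp_shift (A B : List Bool) (n : ℕ) :
    wordPow (B ++ A) (n+1) = B ++ wordPow (A ++ B) n ++ A := by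
  induction n with
  | zero => simp [wordPow]
  | succ n ih => rw [wp_succ, ih, wp_succ]; simp

theorem key (A B A' B' : List Bool) (x : Bool) (n : ℕ) (hn : 0 < n)
    (hA : A = x :: A') (hB : B = B' ++ [x]) :
    ([x] ++ wordPow (A ++ B) n ++ [x]) <:+: (wordPow (B ++ A) n ++ wordPow (B ++ A) n) := by
  obtain ⟨m, rfl⟩ : ∃ m, n = m + 1 := ⟨n - 1, by omega⟩
  rw [← wp_add, show m + 1 + (m + 1) = (m + 1 + 1) + m by ring,
    wp_add _ (m + 1 + 1) m, wp_shift A B (m + 1)]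
  refine ⟨B', A' ++ wordPow (B ++ A) m, ?_⟩
  generalize wordPow (A ++ B) (m+1) = X
  generalize wordPow (B ++ A) m = Y
  subst hA hB
  simp

theorem wp_first (x : Bool) (u : List Bool) (n : ℕ) (hn : 0 < n) (h : ∃ t, u = x :: t) :
    ∃ t, wordPow u n = x :: t := by
  obtain ⟨m, rfl⟩ : ∃ m, n = m + 1 := ⟨n - 1, by omega⟩
  obtain ⟨t, rfl⟩ := h
  exact ⟨_, by rw [wp_succ]; rfl⟩

theorem wp_last (x : Bool) (u : List Bool) (n : ℕ) (hn : 0 < n) (h : ∃ t, u = t ++ [x]) :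
    ∃ t, wordPow u n = t ++ [x] := by
  obtain ⟨m, rfl⟩ : ∃ m, n = m + 1 := ⟨n - 1, by omega⟩
  obtain ⟨t, ht⟩ := h
  exact ⟨wordPow u m ++ t, by rw [wp_succ', List.append_assoc, ← ht]⟩

theorem wc_first (x : Bool) (u : List Bool) (h : ∃ t, u = x :: t) :
    ∃ t, wordCompl u = (!x) :: t := by
  obtain ⟨t, rfl⟩ := h
  exact ⟨wordCompl t, by simp [wordCompl]⟩

theorem wc_last (x : Bool) (u : List Bool) (h : ∃ t, u = t ++ [x]) :
    ∃ t, wordCompl u = t ++ [!x] := by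
  obtain ⟨t, rfl⟩ := h
  exact ⟨wordCompl t, by simp [wordCompl]⟩

theorem alpha_first (s : ℕ → ℕ) (hs : ∀ k, 0 < s k) (k : ℕ) :
    ∃ t, alphaWord s (k+1) = false :: t := by
  induction k with
  | zero => exact ⟨[true], rfl⟩
  | succ k ih =>
    obtain ⟨t, ht⟩ := wp_first _ _ (s (k+1)) (hs _) ih
    rw [alphaWord, ht]
    exact ⟨_, rfl⟩

theorem alpha_last_step (s : ℕ → ℕ) (hs : ∀ k, 0 < s k) (k : ℕ) (x : Bool)
    (h : ∃ t, alphaWord s (k+1) = t ++ [x]) : ∃ t, alphaWord s (k+2) = t ++ [!x] := by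
  obtain ⟨t, ht⟩ := wp_last _ _ (s (k+1)) (hs _) (wc_last _ _ h)
  rw [alphaWord, ht]
  exact ⟨_, (List.append_assoc _ _ _).symm⟩

theorem alpha_last (s : ℕ → ℕ) (hs : ∀ k, 0 < s k) (k : ℕ) :
    ∃ t, alphaWord s (2*k+1) = t ++ [true] := by
  induction k with
  | zero => exact ⟨[false], rfl⟩
  | succ k ih => exact alpha_last_step s hs _ _ (alpha_last_step s hs _ _ ih)

theorem wp_mid (u v : List Bool) (n : ℕ) (hn : 0 < n) :
    (u ++ v) <:+: (wordPow u n ++ wordPow v n) := by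
  obtain ⟨m, rfl⟩ : ∃ m, n = m + 1 := ⟨n - 1, by omega⟩
  exact ⟨wordPow u m, wordPow v m, by rw [wp_succ', wp_succ]; simp⟩

theorem wc_infix (u v : List Bool) (h : u <:+: v) : wordCompl u <:+: wordCompl v := by
  obtain ⟨a, b, rfl⟩ := h
  exact ⟨wordCompl a, wordCompl b, by simp [wordCompl]⟩

theorem sq_compl (s : ℕ → ℕ) (hs : ∀ k, 0 < s k) (k : ℕ) :
    (wordPow (wordCompl (alphaWord s (k+1))) (s (k+1)) ++
      wordPow (wordCompl (alphaWord s (k+1))) (s (k+1))) <:+: alphaWord s (k+3) := by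
  have h := wp_mid (alphaWord s (k+2)) (wordCompl (alphaWord s (k+2))) (s (k+2)) (hs _)
  rw [show alphaWord s (k+3) = _ from alphaWord.eq_3 s (k+1)]
  refine List.IsInfix.trans ?_ h
  rw [alphaWord, wc_append, wc_wp, wc_wp, wc_wc]
  exact ⟨wordPow (alphaWord s (k+1)) (s (k+1)), wordPow (alphaWord s (k+1)) (s (k+1)), by simp⟩

theorem sq_alpha (s : ℕ → ℕ) (hs : ∀ k, 0 < s k) (k : ℕ) :
    (wordPow (alphaWord s (k+1)) (s (k+1)) ++
      wordPow (alphaWord s (k+1)) (s (k+1))) <:+: alphaWord s (k+4) := by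
  have h := wc_infix _ _ (sq_compl s hs k)
  rw [wc_append, wc_wp, wc_wc] at h
  have h2 := wp_mid (alphaWord s (k+3)) (wordCompl (alphaWord s (k+3))) (s (k+3)) (hs _)
  rw [show alphaWord s (k+4) = _ from alphaWord.eq_3 s (k+2)]
  exact (h.trans (List.suffix_append _ _).isInfix).trans h2


theorem padded_powers_in_langL (s : ℕ → ℕ) (hs : ∀ k, 0 < s k) (i : ℕ) (hi : 2 ≤ i)
    (hieven : Even i) :
    ([false] ++ wordPow (alphaWord s i) (s i) ++ [false]) <:+:
        (wordPow (wordCompl (alphaWord s i)) (s i) ++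
          wordPow (wordCompl (alphaWord s i)) (s i)) ∧
    ([true] ++ wordPow (wordCompl (alphaWord s i)) (s i) ++ [true]) <:+:
        (wordPow (alphaWord s i) (s i) ++ wordPow (alphaWord s i) (s i)) ∧
    ([false] ++ wordPow (alphaWord s i) (s i) ++ [false]) ∈ langL s ∧
    ([true] ++ wordPow (wordCompl (alphaWord s i)) (s i) ++ [true]) ∈ langL s := by
  obtain ⟨j, rfl⟩ : ∃ j, i = 2 * j + 1 + 1 := by
    obtain ⟨r, hr⟩ := hieven
    exact ⟨r - 1, by omega⟩
  have hf := alpha_first s hs (2*j)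
  have hl := alpha_last s hs j
  have hp := hs (2*j+1)
  obtain ⟨a, ha⟩ := wp_first _ _ _ hp hf
  obtain ⟨b, hb⟩ := wp_last _ _ _ hp hl
  obtain ⟨c, hc⟩ := wp_first _ _ _ hp (wc_first _ _ hf)
  obtain ⟨d, hd⟩ := wp_last _ _ _ hp (wc_last _ _ hl)
  have e1 : alphaWord s (2*j+1+1) = wordPow (alphaWord s (2*j+1)) (s (2*j+1)) ++
      wordPow (wordCompl (alphaWord s (2*j+1))) (s (2*j+1)) := alphaWord.eq_3 s (2*j)
  have e2 : wordCompl (alphaWord s (2*j+1+1)) =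
      wordPow (wordCompl (alphaWord s (2*j+1))) (s (2*j+1)) ++
      wordPow (alphaWord s (2*j+1)) (s (2*j+1)) := by
    rw [e1, wc_append, wc_wp, wc_wp, wc_wc]
  have k1 := key _ _ _ _ _ (s (2*j+1+1)) (hs _) ha hd
  have k2 := key _ _ _ _ _ (s (2*j+1+1)) (hs _) hc hb
  rw [← e1, ← e2] at k1 k2
  exact ⟨k1, k2, ⟨_, by omega, k1.trans (sq_compl s hs _)⟩, ⟨_, by omega, k2.trans (sq_alpha s hs _)⟩⟩
end
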